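/- Every finite point set S ⊂ ℝ² in general position admits a plane spanning tree T that is 5π/3-open: every vertex of T has an incident angle of size at least 5π/3. -/

import Mathlib

open scoped Classical
open EuclideanGeometry

noncomputable section

abbrev Pt := EuclideanSpace ℝ (Fin 2)

/-- No three points of `S` are collinear. -/
def GenPos (S : Finset Pt) : Prop :=
  ∀ p ∈ S, ∀ q ∈ S, ∀ r ∈ S, p ≠ q → p ≠ r → q ≠ r →
    ¬ Collinear ℝ ({p, q, r} : Set Pt)

/-- A plane straight-line graph on the finite point set `S`: vertices are points of `S`,
edges are recorded as ordered pairs closed under swapping, and two edges that are not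
the same unordered pair may only meet at common endpoints. -/
structure PSLG (S : Finset Pt) where
  E : Finset (Pt × Pt)
  symm : ∀ e ∈ E, (e.2, e.1) ∈ E
  endpts : ∀ e ∈ E, e.1 ∈ S ∧ e.2 ∈ S
  ne : ∀ e ∈ E, e.1 ≠ e.2
  noncross : ∀ e ∈ E, ∀ f ∈ E, e ≠ f → e ≠ (f.2, f.1) →
    ∀ x, x ∈ segment ℝ e.1 e.2 → x ∈ segment ℝ f.1 f.2 →
      (x = e.1 ∨ x = e.2) ∧ (x = f.1 ∨ x = f.2)

/-- The degree of the point `p` in `G`. -/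
def PSLG.deg {S : Finset Pt} (G : PSLG S) (p : Pt) : ℕ :=
  (G.E.filter fun e => e.1 = p).card

/-- The point `p` has an incident angle of size at least `φ` in `G`: all edge directions
at `p` fit in a closed cone of half-angle `π - φ / 2` (for `p` of degree ≤ 1 the maximum
incident angle is `2π`, and this condition holds trivially). -/
def VertexOpen {S : Finset Pt} (G : PSLG S) (p : Pt) (φ : ℝ) : Prop :=
  ∃ d : Pt, d ≠ 0 ∧ ∀ q : Pt, (p, q) ∈ G.E →
    InnerProductGeometry.angle d (q - p) ≤ Real.pi - φ / 2

/-- `G` is `φ`-open: every vertex has an incident angle of size at least `φ`. -/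
def PSLG.IsPhiOpen {S : Finset Pt} (G : PSLG S) (φ : ℝ) : Prop :=
  ∀ p ∈ S, VertexOpen G p φ

/-- `G` is connected on `S`. -/
def PSLG.Connected {S : Finset Pt} (G : PSLG S) : Prop :=
  ∀ p ∈ S, ∀ q ∈ S, Relation.ReflTransGen (fun a b => (a, b) ∈ G.E) p q

/-- `G` is a spanning tree of `S`: connected and with the minimum possible number of
edges (each undirected edge is recorded twice). -/
def PSLG.IsSpanningTree {S : Finset Pt} (G : PSLG S) : Prop :=
  G.Connected ∧ G.E.card = 2 * (S.card - 1)

/-- `G` is a (non-crossing Hamiltonian) spanning path of `S`: a spanning tree of maximum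
vertex degree at most two. -/
def PSLG.IsSpanningPath {S : Finset Pt} (G : PSLG S) : Prop :=
  G.IsSpanningTree ∧ ∀ p ∈ S, G.deg p ≤ 2

/-- `S` is in convex position. -/
def ConvexPos (S : Finset Pt) : Prop :=
  ∀ p ∈ S, p ∉ convexHull ℝ (↑(S.erase p) : Set Pt)

/-- `G` is a triangulation of `S`: a maximal plane straight-line graph, i.e. any further
edge between points of `S` would cross the existing graph. -/
def PSLG.IsTriangulation {S : Finset Pt} (G : PSLG S) : Prop :=
  ∀ p ∈ S, ∀ q ∈ S, p ≠ q → (p, q) ∉ G.E →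
    ∃ e ∈ G.E, ∃ x, x ∈ segment ℝ p q ∧ x ∈ segment ℝ e.1 e.2 ∧
      ¬((x = p ∨ x = q) ∧ (x = e.1 ∨ x = e.2))

end

section Geometry

variable {ι : Type*}

/-- Twice the signed area of the triangle `p q r`, for points with coordinates `x`, `y`. -/
def orient (x y : ι → ℝ) (p q r : ι) : ℝ :=
  (x q - x p) * (y r - y p) - (y q - y p) * (x r - x p)

/-- For a counterclockwise triangle `p q r`: the angle at `q` is at most `π / 3`. -/
def Narrow (x y : ι → ℝ) (p q r : ι) : Prop :=
  orient x y p q r ≤ √3 * ((x p - x q) * (x r - x q) + (y p - y q) * (y r - y q))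

/-- Every point of `S` to the left of `p → q` is seen from `p` within an angle `π / 3` of `q`. -/
def StarLike (S : Finset ι) (x y : ι → ℝ) (p q : ι) : Prop :=
  ∀ r ∈ S, 0 < orient x y p q r → Narrow x y r p q

/-- The points of `S` to the left of `p → q` can be attached to the edge `p q`, without using `q`,
by a star centred at `p` followed by a star centred at one of its leaves `c`. -/
def Attachable (S : Finset ι) (x y : ι → ℝ) (p q : ι) : Prop :=
  (∀ r ∈ S, ¬ 0 < orient x y p q r) ∨
    ∃ c ∈ S, 0 < orient x y p q c ∧ Narrow x y c p q ∧
      ∀ r ∈ S, 0 < orient x y p q r → 0 < orient x y p c r → Narrow x y p c r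

/-- `p → q` is a counterclockwise edge of the convex hull of `S`. -/
def HullEdge (S : Finset ι) (x y : ι → ℝ) (p q : ι) : Prop :=
  p ∈ S ∧ q ∈ S ∧ p ≠ q ∧ ∀ r ∈ S, r ≠ p → r ≠ q → 0 < orient x y p q r

def HullVertex (S : Finset ι) (x y : ι → ℝ) (p : ι) : Prop :=
  (∃ q, HullEdge S x y q p) ∧ ∃ q, HullEdge S x y p q

/-- The points of `S` lie in the lens spanned by `a = (0, 0)` and `b = (1, 0)`. -/
structure InLens (S : Finset ι) (x y : ι → ℝ) (a b : ι) : Prop where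
  ha : a ∈ S
  hb : b ∈ S
  xa : x a = 0
  ya : y a = 0
  xb : x b = 1
  yb : y b = 0
  gp : ∀ p ∈ S, ∀ q ∈ S, ∀ r ∈ S, p ≠ q → p ≠ r → q ≠ r → orient x y p q r ≠ 0
  le_a : ∀ r ∈ S, x r ^ 2 + y r ^ 2 ≤ 1
  le_b : ∀ r ∈ S, (1 - x r) ^ 2 + y r ^ 2 ≤ 1

lemma orient_mirror (x y : ι → ℝ) (p q r : ι) : orient x (-y) p q r = orient x y r q p := by
  simp only [orient, Pi.neg_apply]; ring

lemma narrow_mirror (x y : ι → ℝ) (p q r : ι) : Narrow x (-y) p q r ↔ Narrow x y r q p := by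
  simp only [Narrow, orient_mirror, Pi.neg_apply]
  rw [show (x p - x q) * (x r - x q) + (-y p - -y q) * (-y r - -y q) =
    (x r - x q) * (x p - x q) + (y r - y q) * (y p - y q) by ring]

lemma orient_cycle (x y : ι → ℝ) (p q r : ι) : orient x y p q r = orient x y q r p := by
  simp only [orient]; ring

lemma orient_swap (x y : ι → ℝ) (p q r : ι) : orient x y p q r = - orient x y q p r := by
  simp only [orient]; ring

lemma orient_self_right (x y : ι → ℝ) (p q : ι) : orient x y p q q = 0 := by
  simp only [orient]; ring

lemma orient_self_left (x y : ι → ℝ) (p q : ι) : orient x y p p q = 0 := by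
  simp only [orient]; ring

lemma orient_self_mid (x y : ι → ℝ) (p q : ι) : orient x y p q p = 0 := by
  simp only [orient]; ring

lemma hullEdge_mirror {S : Finset ι} {x y : ι → ℝ} {p q : ι} :
    HullEdge S x (-y) p q ↔ HullEdge S x y q p := by
  unfold HullEdge
  have h : ∀ r, orient x (-y) p q r = orient x y q p r := fun r => by
    rw [orient_mirror, orient_cycle, ← orient_cycle x y r q p, orient_cycle]
  simp only [h]
  constructor
  · rintro ⟨h1, h2, h3, h4⟩
    exact ⟨h2, h1, h3.symm, fun r hr ha hb => h4 r hr hb ha⟩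
  · rintro ⟨h1, h2, h3, h4⟩
    exact ⟨h2, h1, h3.symm, fun r hr ha hb => h4 r hr hb ha⟩

lemma hullVertex_mirror {S : Finset ι} {x y : ι → ℝ} {p : ι} :
    HullVertex S x (-y) p ↔ HullVertex S x y p := by
  simp only [HullVertex, hullEdge_mirror]
  exact And.comm

variable {S : Finset ι} {x y : ι → ℝ} {a b : ι}

lemma InLens.mirror (h : InLens S x y a b) : InLens S x (-y) a b where
  ha := h.ha
  hb := h.hb
  xa := h.xa
  ya := by simp [h.ya]
  xb := h.xb
  yb := by simp [h.yb]
  gp p hp q hq r hr h1 h2 h3 := by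
    rw [orient_mirror]
    exact h.gp r hr q hq p hp h3.symm h2.symm h1.symm
  le_a r hr := by simpa using h.le_a r hr
  le_b r hr := by simpa using h.le_b r hr

lemma HullEdge.exists_next
    (gp : ∀ p ∈ S, ∀ q ∈ S, ∀ r ∈ S, p ≠ q → p ≠ r → q ≠ r → orient x y p q r ≠ 0)
    {p q : ι} (h : HullEdge S x y p q) : ∃ r, HullEdge S x y q r := by
  obtain ⟨hp, hq, hpq, hl⟩ := h
  set T := S.filter fun r => r ≠ p ∧ r ≠ q with hT
  rcases T.eq_empty_or_nonempty with he | hne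
  · refine ⟨p, hq, hp, hpq.symm, fun r hr h1 h2 => ?_⟩
    have : r ∈ T := by simp [hT, hr, h1, h2]
    simp [he] at this
  · obtain ⟨r, hrT, hmax⟩ := T.exists_max_image
      (fun r => ((x q - x p) * (x r - x q) + (y q - y p) * (y r - y q)) / orient x y p q r) hne
    simp only [hT, Finset.mem_filter] at hrT hmax
    obtain ⟨hr, hrp, hrq⟩ := hrT
    have hC := hl r hr hrp hrq
    refine ⟨r, hq, hr, hrq.symm, fun s hs hsq hsr => ?_⟩
    by_cases hsp : s = p
    · rw [hsp, ← orient_cycle]; exact hC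
    · have hC' := hl s hs hsp hsq
      have hm := hmax s ⟨hs, hsp, hsq⟩
      rw [div_le_div_iff₀ hC' hC] at hm
      refine lt_of_le_of_ne ?_ (gp q hq r hr s hs hrq.symm hsq.symm hsr.symm).symm
      have hN : 0 < (x q - x p) ^ 2 + (y q - y p) ^ 2 := by
        rcases eq_or_ne (x q - x p) 0 with h0 | h0
        · rcases eq_or_ne (y q - y p) 0 with h1 | h1
          · simp [orient, h0, h1] at hC
          · positivity
        · positivity
      refine nonneg_of_mul_nonneg_right (a := (x q - x p) ^ 2 + (y q - y p) ^ 2) ?_ hN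
      simp only [orient] at hm ⊢
      nlinarith

lemma HullEdge.exists_prev
    (gp : ∀ p ∈ S, ∀ q ∈ S, ∀ r ∈ S, p ≠ q → p ≠ r → q ≠ r → orient x y p q r ≠ 0)
    {p q : ι} (h : HullEdge S x y p q) : ∃ r, HullEdge S x y r p := by
  obtain ⟨r, hr⟩ := (hullEdge_mirror.mpr h).exists_next (fun p hp q hq r hr h1 h2 h3 => by
    rw [orient_mirror]
    exact gp r hr q hq p hp h3.symm h2.symm h1.symm)
  exact ⟨r, hullEdge_mirror.mp hr⟩

lemma HullEdge.left (hl : InLens S x y a b) {p q : ι} (h : HullEdge S x y p q) :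
    HullVertex S x y p := ⟨h.exists_prev hl.gp, q, h⟩

lemma HullEdge.right (hl : InLens S x y a b) {p q : ι} (h : HullEdge S x y p q) :
    HullVertex S x y q := ⟨⟨p, h⟩, h.exists_next hl.gp⟩

lemma InLens.a_ne_b (h : InLens S x y a b) : a ≠ b := by
  rintro rfl
  have := h.xa
  rw [h.xb] at this
  exact one_ne_zero this

lemma InLens.orient_a (h : InLens S x y a b) (p q : ι) :
    orient x y a p q = x p * y q - y p * x q := by
  simp [orient, h.xa, h.ya]

lemma InLens.orient_ab (h : InLens S x y a b) (p : ι) : orient x y a b p = y p := by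
  simp [h.orient_a, h.xb, h.yb]

lemma InLens.x_pos (h : InLens S x y a b) {p : ι} (hp : p ∈ S) (hpa : p ≠ a) : 0 < x p := by
  by_cases hpb : p = b
  · rw [hpb, h.xb]; exact one_pos
  · have hy := h.gp a h.ha b h.hb p hp h.a_ne_b hpa.symm (Ne.symm hpb)
    rw [h.orient_ab] at hy
    have := h.le_b p hp
    have : 0 < y p ^ 2 := by positivity
    nlinarith

lemma InLens.x_lt_one (h : InLens S x y a b) {p : ι} (hp : p ∈ S) (hpb : p ≠ b) : x p < 1 := by
  by_cases hpa : p = a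
  · rw [hpa, h.xa]; exact one_pos
  · have hy := h.gp a h.ha b h.hb p hp h.a_ne_b (Ne.symm hpa) (Ne.symm hpb)
    rw [h.orient_ab] at hy
    have := h.le_a p hp
    have : 0 < y p ^ 2 := by positivity
    nlinarith

lemma InLens.x_le_one (h : InLens S x y a b) {p : ι} (hp : p ∈ S) : x p ≤ 1 := by
  nlinarith [h.le_a p hp, sq_nonneg (y p)]

/-- Comparison of the directions of `p` and `q` as seen from `a`. -/
lemma InLens.orient_pos_iff (h : InLens S x y a b) {p q : ι} (hp : p ∈ S) (hpa : p ≠ a)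
    (hq : q ∈ S) (hqa : q ≠ a) : 0 < orient x y a p q ↔ y p / x p < y q / x q := by
  rw [h.orient_a, div_lt_div_iff₀ (h.x_pos hp hpa) (h.x_pos hq hqa), sub_pos]
  constructor <;> intro h <;> linarith

lemma InLens.eq_of_slope_eq (h : InLens S x y a b) {p q : ι} (hp : p ∈ S) (hpa : p ≠ a)
    (hq : q ∈ S) (hqa : q ≠ a) (hs : y p / x p = y q / x q) : p = q := by
  by_contra hpq
  apply h.gp a h.ha p hp q hq hpa.symm hqa.symm hpq
  rw [div_eq_div_iff (h.x_pos hp hpa).ne' (h.x_pos hq hqa).ne'] at hs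
  rw [h.orient_a]
  linarith

/-- An angle of at most `π / 3` from `v` to `u` contains all angles from `v` to vectors between. -/
lemma narrow_vec {v1 v2 z1 z2 u1 u2 : ℝ} (hzu : 0 ≤ z1 * u2 - z2 * u1)
    (hvz : 0 ≤ v1 * z2 - v2 * z1) (hvu : 0 < v1 * u2 - v2 * u1)
    (h : v1 * u2 - v2 * u1 ≤ √3 * (v1 * u1 + v2 * u2)) :
    v1 * z2 - v2 * z1 ≤ √3 * (v1 * z1 + v2 * z2) := by
  have h3 : (0 : ℝ) ≤ √3 := Real.sqrt_nonneg 3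
  have h1 := mul_nonneg hvz (sub_nonneg.mpr h)
  have h2 := mul_nonneg hzu (mul_nonneg h3 (add_nonneg (sq_nonneg v1) (sq_nonneg v2)))
  refine sub_nonneg.mp (nonneg_of_mul_nonneg_right (a := v1 * u2 - v2 * u1) ?_ hvu)
  linear_combination h1 + h2

lemma narrow_vec_left {v1 v2 z1 z2 u1 u2 : ℝ} (hzu : 0 ≤ z1 * u2 - z2 * u1)
    (hvz : 0 ≤ v1 * z2 - v2 * z1) (hvu : 0 < v1 * u2 - v2 * u1)
    (h : v1 * u2 - v2 * u1 ≤ √3 * (v1 * u1 + v2 * u2)) :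
    z1 * u2 - z2 * u1 ≤ √3 * (z1 * u1 + z2 * u2) := by
  have h3 : (0 : ℝ) ≤ √3 := Real.sqrt_nonneg 3
  have h1 := mul_nonneg hzu (sub_nonneg.mpr h)
  have h2 := mul_nonneg hvz (mul_nonneg h3 (add_nonneg (sq_nonneg u1) (sq_nonneg u2)))
  refine sub_nonneg.mp (nonneg_of_mul_nonneg_right (a := v1 * u2 - v2 * u1) ?_ hvu)
  linear_combination h1 + h2

/-- If `r` lies between `q` and `s` as seen from `p`, its angle with `s` is at most that of `q`. -/
lemma Narrow.of_between {p q r s : ι} (hrq : 0 ≤ orient x y p r q) (hsr : 0 ≤ orient x y p s r)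
    (hsq : 0 < orient x y p s q) (hn : Narrow x y q p s) : Narrow x y r p s := by
  simp only [Narrow, orient] at *
  have := narrow_vec hrq hsr hsq (by linear_combination hn)
  linear_combination this

/-- If `r` lies between `q` and `s` as seen from `p`, its angle with `q` is at most that of `s`. -/
lemma Narrow.of_between_left {p q r s : ι} (hrq : 0 ≤ orient x y p r q)
    (hsr : 0 ≤ orient x y p s r) (hsq : 0 < orient x y p s q) (hn : Narrow x y q p s) :
    Narrow x y q p r := by
  simp only [Narrow, orient] at *
  have := narrow_vec_left hrq hsr hsq (by linear_combination hn)
  linear_combination this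

lemma StarLike.attachable {p q : ι} (h : StarLike S x y p q) : Attachable S x y p q := by
  set T := S.filter fun r => 0 < orient x y p q r with hT
  rcases T.eq_empty_or_nonempty with he | hne
  · left
    intro r hr h1
    have : r ∈ T := by simp [hT, hr, h1]
    simp [he] at this
  · obtain ⟨c, hcT, hmin⟩ := T.exists_min_image
      (fun r => ((x q - x p) * (x r - x p) + (y q - y p) * (y r - y p)) / orient x y p q r) hne
    simp only [hT, Finset.mem_filter] at hcT hmin
    obtain ⟨hc, hC⟩ := hcT
    refine Or.inr ⟨c, hc, hC, h c hc hC, fun r hr h1 h2 => ?_⟩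
    have hm := hmin r ⟨hr, h1⟩
    rw [div_le_div_iff₀ hC h1] at hm
    have hN : 0 < (x q - x p) ^ 2 + (y q - y p) ^ 2 := by
      rcases eq_or_ne (x q - x p) 0 with h0 | h0
      · rcases eq_or_ne (y q - y p) 0 with h1 | h1
        · simp [orient, h0, h1] at hC
        · positivity
      · positivity
    have := mul_pos hN h2
    simp only [orient] at hm this
    nlinarith

lemma HullEdge.starLike {w v : ι} (ha : a ∈ S) (h : HullEdge S x y w v) (haw : a ≠ w)
    (hav : a ≠ v) (hn : Narrow x y w v a) : StarLike S x y v a := by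
  intro r hr hr0
  by_cases hrw : r = w
  · rwa [hrw]
  · have hrv : r ≠ v := by rintro rfl; simp [orient_self_mid] at hr0
    refine hn.of_between ?_ hr0.le ?_
    · rw [← orient_cycle]; exact (h.2.2.2 r hr hrw hrv).le
    · rw [← orient_cycle]; exact h.2.2.2 a ha haw hav

lemma narrow_of_turn {h w v : ι} (h1 : 0 < orient x y a w h) (h2 : 0 < orient x y h w v)
    (h3 : 0 < orient x y a v h) (h4 : 0 < orient x y a w v) (hwa : Narrow x y w h a)
    (hwv : ¬ Narrow x y h w v) (hav : Narrow x y h a v) : Narrow x y w v a := by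
  have h30 : (0 : ℝ) < √3 := Real.sqrt_pos.mpr (by norm_num)
  have e3 : √3 * √3 = 3 := Real.mul_self_sqrt (by norm_num)
  simp only [Narrow, orient, not_le] at *
  have hY : 0 < (x h - x w) ^ 2 + (y h - y w) ^ 2 := by
    rcases eq_or_ne (x h - x w) 0 with h0 | h0
    · rcases eq_or_ne (y h - y w) 0 with h5 | h5
      · rw [show x h = x w by linarith, show y h = y w by linarith] at h2
        simp at h2
      · positivity
    · positivity
  have key : 0 ≤ (x v - x w) * (y h - y a) - (y v - y w) * (x h - x a) := by
    refine nonneg_of_mul_nonneg_right (a := √3 * ((x h - x w) ^ 2 + (y h - y w) ^ 2)) ?_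
      (by positivity)
    have i1 := mul_nonneg (sub_nonneg.mpr hwv.le) h1.le
    have i2 := mul_nonneg h2.le (sub_nonneg.mpr hwa)
    linear_combination i1 + i2
  have := narrow_vec (v1 := x v - x a) (v2 := y v - y a) (z1 := x v - x w) (z2 := y v - y w)
    (u1 := x h - x a) (u2 := y h - y a) key (by linear_combination h4) h3
    (by linear_combination hav)
  linear_combination this

/-- If the points below `h` cannot be attached using `w`, then the next hull vertex `v` after `w`
sees everything below it within an angle `π / 3`. -/
lemma HullEdge.starLike_of_not_attachable {h w v : ι} (ha : a ∈ S) (hh : h ∈ S)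
    (hwv : HullEdge S x y w v) (haw : a ≠ w) (hav : a ≠ v) (hhw : h ≠ w)
    (h1 : 0 < orient x y a w h) (h3 : v ≠ h → 0 < orient x y a v h)
    (hwa : Narrow x y w h a) (hv : Narrow x y h a v) (hn : ¬ Attachable S x y h a) :
    StarLike S x y v a := by
  apply hwv.starLike ha haw hav
  obtain ⟨r, hr, hr1, hr2, hr3⟩ : ∃ r ∈ S, 0 < orient x y h a r ∧ 0 < orient x y h w r ∧
      ¬ Narrow x y h w r := by
    by_contra! hcon
    exact hn (Or.inr ⟨w, hwv.1, by rwa [orient_cycle], hwa, hcon⟩)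
  have hrw : r ≠ w := by rintro rfl; simp [orient_self_right] at hr2
  have hvh : v ≠ h := by
    rintro rfl
    rcases eq_or_ne r v with rfl | hrv
    · simp [orient_self_mid] at hr2
    · have := hwv.2.2.2 r hr hrw hrv
      rw [orient_swap] at this
      linarith
  have h2 : 0 < orient x y h w v := by
    rw [orient_cycle]; exact hwv.2.2.2 h hh hhw hvh.symm
  have h4 : 0 < orient x y a w v := by
    rw [orient_cycle]; exact hwv.2.2.2 a ha haw hav
  refine narrow_of_turn h1 h2 (h3 hvh) h4 hwa (fun hN => hr3 ?_) hv
  rcases eq_or_ne r v with rfl | hrv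
  · exact hN
  · refine hN.of_between_left (p := w) ?_ ?_ ?_
    · rw [← orient_cycle]; exact hr2.le
    · exact (hwv.2.2.2 r hr hrw hrv).le
    · rw [← orient_cycle]; exact h2

lemma lens_of_steep {x1 y1 : ℝ} (hx1 : 0 < x1) (hx : x1 ≤ 1) (h1 : √3 * x1 < y1)
    (ha : x1 ^ 2 + y1 ^ 2 ≤ 1) :
    y1 ≤ √3 * (1 - x1) := by
  have h30 : (0 : ℝ) < √3 := Real.sqrt_pos.mpr (by norm_num)
  have e3 : √3 ^ 2 = 3 := Real.sq_sqrt (by norm_num)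
  by_contra! hc
  have i1 : (√3 * (1 - x1)) ^ 2 < y1 ^ 2 :=
    pow_lt_pow_left₀ hc (mul_nonneg h30.le (by linarith)) two_ne_zero
  have i2 : (√3 * x1) ^ 2 < y1 ^ 2 := pow_lt_pow_left₀ h1 (by positivity) two_ne_zero
  rw [mul_pow, e3] at i1 i2
  nlinarith

lemma turn_dir {x1 y1 x2 y2 : ℝ} (hx1 : 0 < x1) (hx11 : x1 < 1) (hy1 : 0 < y1)
    (h1 : y1 ≤ √3 * (1 - x1))
    (hs : 0 < x2 * y1 - y2 * x1) (hb : 0 < y2 * (1 - x1) - y1 * (1 - x2))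
    (hn : √3 * ((x2 - x1) * (1 - x1) + (y2 - y1) * (0 - y1)) < y2 * (1 - x1) - y1 * (1 - x2)) :
    x1 ≤ x2 ∧ y1 < y2 := by
  have h30 : (0 : ℝ) < √3 := Real.sqrt_pos.mpr (by norm_num)
  have hx : x1 ≤ x2 := by
    by_contra! hc
    have : y1 < y2 := by nlinarith
    nlinarith
  refine ⟨hx, ?_⟩
  by_contra! hc
  have i1 := mul_nonneg (sub_nonneg.mpr hx) (sub_nonneg.mpr h1)
  have i2 := mul_nonneg (sub_nonneg.mpr hc) (by positivity : 0 ≤ √3 * y1)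
  nlinarith [mul_nonneg (sub_nonneg.mpr hc) (sub_nonneg.mpr hx11.le)]

lemma flat_of_turn {x1 y1 x2 y2 : ℝ} (hx1 : 0 < x1) (hx2 : x2 ≤ 1)
    (h0 : √3 * x1 < y1) (h1 : y1 ≤ √3 * (1 - x1)) (hy : y1 < y2)
    (hn : √3 * ((x2 - x1) * (1 - x1) + (y2 - y1) * (0 - y1)) < y2 * (1 - x1) - y1 * (1 - x2)) :
    x2 ≤ √3 * y2 := by
  have h30 : (0 : ℝ) < √3 := Real.sqrt_pos.mpr (by norm_num)
  have e3 : √3 * √3 = 3 := Real.mul_self_sqrt (by norm_num)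
  by_contra! hc
  have hy1 : 0 < y1 := by nlinarith
  have hα : 0 < x2 - √3 * y1 := by nlinarith
  have hγ : 0 < 1 - √3 * y1 := by linarith
  have p1 : 0 ≤ (√3 * y1 - x1) * (√3 * (1 - x1) - y1) := by
    apply mul_nonneg _ (by linarith)
    nlinarith
  have p2 : 0 ≤ 3 * (1 - x1) ^ 2 - (1 - x1) + 3 * y1 ^ 2 - √3 * y1 := by
    have hd : 1 - √3 * y1 / 3 ≤ 1 - x1 := by nlinarith
    have : 3 * y1 ^ 2 = (√3 * y1) ^ 2 := by rw [mul_pow, pow_two √3, e3]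
    rw [this]
    generalize √3 * y1 = t at *
    have ht : 0 < t := by nlinarith
    nlinarith [mul_nonneg (sub_nonneg.mpr hd)
      (by nlinarith : 0 ≤ (1 - x1) + (1 - t / 3) - 1 / 3), sq_nonneg (t - 1)]
  have p3 : √3 * ((x2 - x1) * (√3 * (1 - x1) - y1)) - x2 * (√3 * y1 + (1 - x1)) +
      √3 * y1 * (√3 * y1 + (1 - x1)) < 0 := by
    have : 0 < √3 * y1 + (1 - x1) := by nlinarith
    nlinarith [mul_lt_mul_of_pos_right hc this, mul_lt_mul_of_pos_left hn h30]
  have := mul_neg_of_pos_of_neg hγ p3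
  have j1 := mul_nonneg (sub_nonneg.mpr hx2) (mul_nonneg h30.le p1)
  have j2 := mul_nonneg hα.le p2
  have k : (1 - √3 * y1) * (√3 * ((x2 - x1) * (√3 * (1 - x1) - y1)) -
      x2 * (√3 * y1 + (1 - x1)) + √3 * y1 * (√3 * y1 + (1 - x1))) =
      (1 - x2) * (√3 * ((√3 * y1 - x1) * (√3 * (1 - x1) - y1))) +
      (x2 - √3 * y1) * (3 * (1 - x1) ^ 2 - (1 - x1) + 3 * y1 ^ 2 - √3 * y1) := by
    grind
  linarith

lemma InLens.ne_a (hl : InLens S x y a b) {r : ι} (hr : y r ≠ 0) : r ≠ a := by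
  rintro rfl; exact hr hl.ya

lemma InLens.ne_b (hl : InLens S x y a b) {r : ι} (hr : y r ≠ 0) : r ≠ b := by
  rintro rfl; exact hr hl.yb

/-- The hull vertex before a vertex `l` above `a b`. -/
lemma InLens.prev_upper (hl : InLens S x y a b) {f l : ι} (h : HullEdge S x y f l) (hy : 0 < y l) :
    f ≠ a ∧ y f / x f < y l / x l ∧ (f = b ∨ 0 < y f) := by
  have hla := hl.ne_a hy.ne'
  have hlb := hl.ne_b hy.ne'
  have hfa : f ≠ a := by
    rintro rfl
    have := h.2.2.2 b hl.hb hl.a_ne_b.symm hlb.symm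
    rw [hl.orient_a, hl.xb, hl.yb] at this
    linarith
  refine ⟨hfa, ?_, ?_⟩
  · rw [← hl.orient_pos_iff h.1 hfa h.2.1 hla, orient_cycle]
    exact h.2.2.2 a hl.ha hfa.symm hla.symm
  · by_contra! hc
    obtain ⟨hfb, hfy⟩ := hc
    have hb := h.2.2.2 b hl.hb hfb.symm hlb.symm
    have h1 := hl.x_lt_one h.1 hfb
    have h2 := hl.x_lt_one h.2.1 hlb
    simp only [orient, hl.xb, hl.yb] at hb
    nlinarith

lemma InLens.hullEdge_of_max (hl : InLens S x y a b) {e : ι} (he : e ∈ S) (hea : e ≠ a)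
    (hmax : ∀ r ∈ S, r ≠ a → y r / x r ≤ y e / x e) : HullEdge S x y e a := by
  refine ⟨he, hl.ha, hea, fun r hr hre hra => ?_⟩
  rw [orient_cycle, hl.orient_pos_iff hr hra he hea]
  exact lt_of_le_of_ne (hmax r hr hra) fun h => hre (hl.eq_of_slope_eq hr hra he hea h)

lemma InLens.narrow_a (hl : InLens S x y a b) {p q : ι} :
    Narrow x y p a q ↔ x q * y p - y q * x p ≤ √3 * (x q * x p + y q * y p) := by
  rw [Narrow, orient_cycle, hl.orient_a, hl.xa, hl.ya]
  simp only [sub_zero, mul_comm]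

/-- If the points above `b → a` cannot be attached at `b`, there is a hull vertex `f` at which
a star seeing `a` can be centred. -/
lemma InLens.exists_good (hl : InLens S x y a b) (hn : ¬ Attachable S x (-y) b a) :
    ∃ f ∈ S, 0 < y f ∧ y f ≤ √3 * x f ∧ HullVertex S x y f ∧ StarLike S x (-y) f a ∧
      Attachable S x y a f := by
  have hba : ∀ r, orient x (-y) b a r = y r := fun r => by
    rw [orient_mirror, orient_cycle, hl.orient_ab]
  unfold Attachable at hn
  push Not at hn
  obtain ⟨⟨r₀, hr₀, hy₀⟩, hn⟩ := hn
  rw [hba] at hy₀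
  have hr₀a := hl.ne_a hy₀.ne'
  obtain ⟨e, heT, hmax⟩ := (S.erase a).exists_max_image (fun r => y r / x r)
    ⟨r₀, Finset.mem_erase.mpr ⟨hr₀a, hr₀⟩⟩
  simp only [Finset.mem_erase] at heT hmax
  obtain ⟨hea, he⟩ := heT
  have hE := hl.hullEdge_of_max he hea fun r hr hra => hmax r ⟨hra, hr⟩
  have hye : 0 < y e := by
    have h1 := div_pos hy₀ (hl.x_pos hr₀ hr₀a)
    have h2 := h1.trans_le (hmax r₀ ⟨hr₀a, hr₀⟩)
    exact (div_pos_iff_of_pos_right (hl.x_pos he hea)).mp h2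
  have hno : ∀ r ∈ S, ¬ 0 < orient x y a e r := by
    intro r hr
    by_cases hra : r = a
    · simp [hra, orient_self_mid]
    · rw [hl.orient_pos_iff he hea hr hra, not_lt]
      exact hmax r ⟨hra, hr⟩
  by_cases hes : y e ≤ √3 * x e
  · refine ⟨e, he, hye, hes, hE.left hl, fun r hr h0 => ?_, Or.inl hno⟩
    rw [orient_mirror, orient_cycle] at h0
    exact absurd h0 (hno r hr)
  push Not at hes
  obtain ⟨l, hlT, hmin⟩ := (S.filter fun r =>
    0 < y r ∧ HullVertex S x y r ∧ √3 * x r < y r).exists_min_image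
    (fun r => y r / x r) ⟨e, by simp [he, hye, hE.left hl, hes]⟩
  simp only [Finset.mem_filter] at hlT hmin
  obtain ⟨hlS, hly, ⟨⟨f, hfl⟩, -⟩, hls⟩ := hlT
  have hla := hl.ne_a hly.ne'
  have hlb := hl.ne_b hly.ne'
  obtain ⟨hfa, hsl, hfy⟩ := hl.prev_upper hfl hly
  have hf := hfl.1
  have hxl := hl.x_pos hlS hla
  have hxf := hl.x_pos hf hfa
  have hlens := lens_of_steep hxl (hl.x_le_one hlS) hls (hl.le_a l hlS)
  obtain ⟨r, hr, hry, hr1, hr2⟩ := hn l hlS (by rwa [hba]) (by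
    rw [narrow_mirror, Narrow, hl.orient_ab]
    simp only [hl.xa, hl.xb, hl.ya, hl.yb]
    linarith)
  rw [hba] at hry
  have hrb := hl.ne_b hry.ne'
  rw [orient_mirror] at hr1
  rw [narrow_mirror] at hr2
  have hrl : r ≠ l := by rintro rfl; simp [orient_self_left] at hr1
  have hfb : f ≠ b := by
    rintro rfl
    have := hfl.2.2.2 r hr hrb hrl
    rw [orient_swap, ← orient_cycle] at this
    linarith
  have hfy : 0 < y f := hfy.resolve_left hfb
  have hfs : y f ≤ √3 * x f := by
    by_contra! hc
    exact (hmin f ⟨hf, hfy, hfl.left hl, hc⟩).not_gt hsl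
  have hfb' := hfl.2.2.2 b hl.hb hfb.symm hlb.symm
  have hNf : ¬ Narrow x y f l b := by
    intro hN
    rcases eq_or_ne r f with rfl | hrf
    · exact hr2 hN
    · refine hr2 (hN.of_between ?_ ?_ ?_)
      · rw [← orient_cycle]; exact (hfl.2.2.2 r hr hrf hrl).le
      · rw [← orient_cycle]; exact hr1.le
      · rwa [← orient_cycle]
  have hsl' := (hl.orient_pos_iff hf hfa hlS hla).mpr hsl
  rw [hl.orient_a] at hsl'
  have hob : orient x y f l b = y f * (1 - x l) - y l * (1 - x f) := by
    simp only [orient, hl.xb, hl.yb]; ring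
  rw [Narrow, not_le, hob, hl.xb, hl.yb] at hNf
  rw [hob] at hfb'
  obtain ⟨d1, d2⟩ := turn_dir hxl (hl.x_lt_one hlS hlb) hly hlens hsl' hfb' hNf
  have d3 := flat_of_turn hxl (hl.x_le_one hf) hls hlens d2 hNf
  have hfe : y f / x f < y e / x e := hsl.trans_le (hmax l ⟨hla, hlS⟩)
  refine ⟨f, hf, hfy, hfs, hfl.left hl, ?_, Or.inr ⟨e, he,
    (hl.orient_pos_iff hf hfa he hea).mpr hfe, ?_, fun r hr _ h0 => absurd h0 (hno r hr)⟩⟩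
  · refine HullEdge.starLike hl.ha (hullEdge_mirror.mpr hfl) hla.symm hfa.symm ?_
    rw [narrow_mirror, Narrow, hl.orient_a, hl.xa, hl.ya]
    have i1 := mul_nonneg (sub_nonneg.mpr d1) (sub_nonneg.mpr hfs)
    have i2 := mul_nonneg (sub_nonneg.mpr d2.le) (by positivity : 0 ≤ √3 * y f + x f)
    linear_combination i1 + i2
  · rw [hl.narrow_a]
    have hxe := hl.x_pos he hea
    have i1 := mul_nonneg (sub_nonneg.mpr d3) hye.le
    have : 0 ≤ √3 * x f * x e + y f * x e := by positivity
    linarith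

lemma attachable_of_starLike {p q c : ι} (hc : c ∈ S) (hpqc : 0 < orient x y p q c)
    (hn : Narrow x y c p q) (hs : StarLike S x (-y) c p) : Attachable S x y p q := by
  refine Or.inr ⟨c, hc, hpqc, hn, fun r hr _ h0 => ?_⟩
  rw [← narrow_mirror]
  refine hs r hr ?_
  rwa [orient_mirror, orient_cycle]

lemma InLens.narrow_b (hl : InLens S x y a b) {f : ι} (hf : y f ≤ √3 * x f) :
    Narrow x y f a b := by
  rw [hl.narrow_a, hl.xb, hl.yb]
  linarith

lemma InLens.attachable_below (hl : InLens S x y a b) {f h : ι} (hf : f ∈ S) (hfy : 0 < y f)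
    (hfs : y f ≤ √3 * x f) (hst : StarLike S x (-y) f a) (hat : Attachable S x y a f)
    (hh : h ∈ S) (hhy : 0 < y h) (hle : y h / x h ≤ y f / x f) : Attachable S x y a h := by
  have hfa := hl.ne_a hfy.ne'
  have hha := hl.ne_a hhy.ne'
  rcases eq_or_ne h f with rfl | hhf
  · exact hat
  · have h1 : 0 < orient x y a h f := (hl.orient_pos_iff hh hha hf hfa).mpr
      (lt_of_le_of_ne hle fun h => hhf (hl.eq_of_slope_eq hh hha hf hfa h))
    refine attachable_of_starLike hf h1 ((hl.narrow_b hfs).of_between_left h1.le ?_ ?_) hst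
    · rw [hl.orient_ab]; exact hhy.le
    · rwa [hl.orient_ab]

lemma narrow_or_narrow_of_not_narrow {h w : ι} (h0 : 0 < orient x y a w h)
    (hn : ¬ Narrow x y h a w) : Narrow x y w h a ∨ Narrow x y a w h := by
  by_contra! hc
  obtain ⟨h1, h2⟩ := hc
  rw [Narrow, not_le] at hn h1 h2
  rw [orient_cycle] at hn
  rw [← orient_cycle] at h1
  have e3 : √3 * √3 = 3 := Real.mul_self_sqrt (by norm_num)
  have h30 : (0 : ℝ) < √3 := Real.sqrt_pos.mpr (by norm_num)
  have hD : orient x y a w h ^ 2 =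
    ((x h - x a) * (x w - x a) + (y h - y a) * (y w - y a)) *
      ((x w - x h) * (x a - x h) + (y w - y h) * (y a - y h)) +
    ((x h - x a) * (x w - x a) + (y h - y a) * (y w - y a)) *
      ((x a - x w) * (x h - x w) + (y a - y w) * (y h - y w)) +
    ((x w - x h) * (x a - x h) + (y w - y h) * (y a - y h)) *
      ((x a - x w) * (x h - x w) + (y a - y w) * (y h - y w)) := by
    simp only [orient]; ring
  have p1 : 0 ≤ ((x h - x a) * (x w - x a) + (y h - y a) * (y w - y a)) +
      ((x w - x h) * (x a - x h) + (y w - y h) * (y a - y h)) := by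
    nlinarith [sq_nonneg (x h - x a), sq_nonneg (y h - y a)]
  generalize orient x y a w h = D at *
  generalize (x h - x a) * (x w - x a) + (y h - y a) * (y w - y a) = u at *
  generalize (x w - x h) * (x a - x h) + (y w - y h) * (y a - y h) = v at *
  generalize (x a - x w) * (x h - x w) + (y a - y w) * (y h - y w) = z at *
  have i1 : √3 * z * (u + v) ≤ D * (u + v) := mul_le_mul_of_nonneg_right h2.le p1
  have i2 : √3 * (u * v + z * (u + v)) = √3 * D ^ 2 := by rw [hD]; ring
  have i3 : 3 * D ^ 2 ≤ (√3 * u) * (√3 * v) + D * (√3 * u + √3 * v) := by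
    nlinarith [mul_le_mul_of_nonneg_left i1 h30.le]
  have p2 : 0 ≤ √3 * u + √3 * v := by nlinarith
  generalize √3 * u = u' at *
  generalize √3 * v = v' at *
  nlinarith

lemma InLens.not_narrow_side (hl : InLens S x y a b) {h w : ι}
    (hNP : ∀ p ∈ S, ∀ q ∈ S, p ≠ q → ¬ (Attachable S x y p q ∧ Attachable S x y q p))
    (hb : ¬ Attachable S x y b a) (hh : h ∈ S) (hhy : 0 < y h) (hhs : y h ≤ √3 * x h)
    (hw : w ∈ S) (hwy : y w < 0) (hwv : HullVertex S x y w) (hat : Attachable S x y a h)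
    (hmax : ∀ v ∈ S, y v < 0 → HullVertex S x y v → y w / x w < y v / x v →
      Narrow x y h a v ∧ ¬ StarLike S x y v a) : ¬ Narrow x y w h a := by
  intro hN
  obtain ⟨-, v, hv⟩ := hwv
  have hwa := hl.ne_a hwy.ne
  have hha := hl.ne_a hhy.ne'
  obtain ⟨hva, hsl, hvb⟩ := hl.mirror.prev_upper (hullEdge_mirror.mpr hv) (by simpa using hwy)
  simp only [Pi.neg_apply, neg_div, neg_lt_neg_iff, Left.neg_pos_iff] at hsl hvb
  have hxh := hl.x_pos hh hha
  have hxw := hl.x_pos hw hwa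
  have hxv := hl.x_pos hv.2.1 hva
  have hsh := div_pos hhy hxh
  have h1 : 0 < orient x y a w h := (hl.orient_pos_iff hw hwa hh hha).mpr
    ((div_neg_of_neg_of_pos hwy hxw).trans hsh)
  have h3 : 0 < orient x y a v h := by
    refine (hl.orient_pos_iff hv.2.1 hva hh hha).mpr (lt_of_le_of_lt ?_ hsh)
    rcases hvb with rfl | hvy
    · simp [hl.yb]
    · exact (div_neg_of_neg_of_pos hvy hxv).le
  have hNv : Narrow x y h a v := by
    rcases hvb with rfl | hvy
    · exact hl.narrow_b hhs
    · exact (hmax v hv.2.1 hvy (hv.right hl) hsl).1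
  have hst := hv.starLike_of_not_attachable hl.ha hh hwa.symm hva.symm
    (by rintro rfl; linarith) h1 (fun _ => h3) hN hNv (fun hh1 => hNP a hl.ha h hh hha.symm ⟨hat, hh1⟩)
  rcases hvb with rfl | hvy
  · exact hb hst.attachable
  · exact (hmax v hv.2.1 hvy (hv.right hl) hsl).2 hst

lemma InLens.exists_attachable_of_not (hl : InLens S x y a b)
    (hB : ¬ Attachable S x (-y) b a) (hB' : ¬ Attachable S x y b a) :
    ∃ p ∈ S, ∃ q ∈ S, p ≠ q ∧ ((Attachable S x y p q ∧ Attachable S x y q p) ∨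
      (Attachable S x (-y) p q ∧ Attachable S x (-y) q p)) := by
  by_contra! hcon
  have hNP : ∀ p ∈ S, ∀ q ∈ S, p ≠ q → ¬ (Attachable S x y p q ∧ Attachable S x y q p) :=
    fun p hp q hq hpq h => (hcon p hp q hq hpq).1 h.1 h.2
  have hNP' : ∀ p ∈ S, ∀ q ∈ S, p ≠ q → ¬ (Attachable S x (-y) p q ∧ Attachable S x (-y) q p) :=
    fun p hp q hq hpq h => (hcon p hp q hq hpq).2 h.1 h.2
  obtain ⟨f, hf, hfy, hfs, hfv, hfst, hfat⟩ := hl.exists_good hB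
  obtain ⟨g, hg, hgy, hgs, hgv, hgst, hgat⟩ := hl.mirror.exists_good (by rwa [neg_neg])
  rw [hullVertex_mirror] at hgv
  have hgst' := hgst
  rw [neg_neg] at hgst
  obtain ⟨s, hsT, hsmin⟩ := (S.filter fun r => 0 < y r ∧ HullVertex S x y r ∧
    StarLike S x (-y) r a).exists_min_image (fun r => y r / x r) ⟨f, by simp [hf, hfy, hfv, hfst]⟩
  obtain ⟨t, htT, htmax⟩ := (S.filter fun r => y r < 0 ∧ HullVertex S x y r ∧
    StarLike S x y r a).exists_max_image (fun r => y r / x r)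
    ⟨g, by simpa [hg, hgv, hgst] using hgy⟩
  simp only [Finset.mem_filter] at hsT htT hsmin htmax
  obtain ⟨hs, hsy, hsv, hsst⟩ := hsT
  obtain ⟨ht, hty, htv, htst⟩ := htT
  have hsign : ∀ h ∈ S, ∀ w ∈ S, 0 < y h → y w < 0 → 0 < orient x y a w h := fun h hh w hw h1 h2 =>
    (hl.orient_pos_iff hw (hl.ne_a h2.ne) hh (hl.ne_a h1.ne')).mpr
      ((div_neg_of_neg_of_pos h2 (hl.x_pos hw (hl.ne_a h2.ne))).trans
        (div_pos h1 (hl.x_pos hh (hl.ne_a h1.ne'))))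
  have hst : ¬ Narrow x y s a t := fun hN => hNP a hl.ha t ht (hl.ne_a hty.ne).symm
    ⟨attachable_of_starLike hs (hsign s hs t ht hsy hty) hN hsst, htst.attachable⟩
  obtain ⟨h, hhT, hhmin⟩ := (S.filter fun h => 0 < y h ∧ HullVertex S x y h ∧
    y h / x h ≤ y s / x s ∧ ∃ w ∈ S, y w < 0 ∧ HullVertex S x y w ∧ y t / x t ≤ y w / x w ∧
      ¬ Narrow x y h a w).exists_min_image (fun r => y r / x r)
    ⟨s, by simpa [hs, hsy, hsv] using ⟨t, ht, hty, htv, le_rfl, hst⟩⟩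
  simp only [Finset.mem_filter] at hhT hhmin
  obtain ⟨hh, hhy, hhv, hhs, w₀, hw₀⟩ := hhT
  obtain ⟨w, hwT, hwmax⟩ := (S.filter fun w => y w < 0 ∧ HullVertex S x y w ∧
    y t / x t ≤ y w / x w ∧ ¬ Narrow x y h a w).exists_max_image (fun r => y r / x r)
    ⟨w₀, by simpa using hw₀⟩
  simp only [Finset.mem_filter] at hwT hwmax
  obtain ⟨hw, hwy, hwv, hwt, hhw⟩ := hwT
  have hfh : y h / x h ≤ y f / x f := hhs.trans (hsmin f ⟨hf, hfy, hfv, hfst⟩)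
  have hgw : y g / x g ≤ y w / x w :=
    (htmax g ⟨hg, by simpa using hgy, hgv, hgst⟩).trans hwt
  have hslope : ∀ {y : ι → ℝ} {h f : ι}, InLens S x y a b → h ∈ S → f ∈ S → 0 < y h → 0 < y f →
      y h / x h ≤ y f / x f → y f ≤ √3 * x f → y h ≤ √3 * x h := by
    intro y h f hl hh hf hhy hfy hle hfs
    rw [← div_le_iff₀ (hl.x_pos hh (hl.ne_a hhy.ne'))]
    exact hle.trans ((div_le_iff₀ (hl.x_pos hf (hl.ne_a hfy.ne'))).mpr hfs)
  have hgw' : (-y) w / x w ≤ (-y) g / x g := by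
    simpa only [Pi.neg_apply, neg_div, neg_le_neg_iff] using hgw
  have hwy' : 0 < (-y) w := by simpa using hwy
  rcases narrow_or_narrow_of_not_narrow (hsign h hh w hw hhy hwy) hhw with hN | hN
  · refine hl.not_narrow_side hNP hB' hh hhy (hslope hl hh hf hhy hfy hfh hfs) hw hwy hwv
      (hl.attachable_below hf hfy hfs hfst hfat hh hhy hfh) (fun v hv hvy hvv hwv => ⟨?_, ?_⟩) hN
    · by_contra hc
      exact (hwmax v ⟨hv, hvy, hvv, hwt.trans hwv.le, hc⟩).not_gt hwv
    · intro hc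
      exact ((htmax v ⟨hv, hvy, hvv, hc⟩).trans hwt).not_gt hwv
  · refine hl.mirror.not_narrow_side hNP' hB hw hwy' (hslope hl.mirror hw hg hwy' hgy hgw' hgs)
      hh (by simpa using hhy) (hullVertex_mirror.mpr hhv)
      (hl.mirror.attachable_below hg hgy hgs hgst' hgat hw hwy' hgw')
      (fun u hu huy huv hhu => ?_) ((narrow_mirror x y h w a).mpr hN)
    simp only [Pi.neg_apply, neg_div, neg_lt_neg_iff, Left.neg_neg_iff] at huy hhu
    rw [hullVertex_mirror] at huv
    refine ⟨?_, fun hc => ?_⟩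
    · rw [narrow_mirror]
      by_contra hc
      exact (hhmin u ⟨hu, huy, huv, hhu.le.trans hhs, w, hw, hwy, hwv, hwt, hc⟩).not_gt hhu
    · exact (hhs.trans (hsmin u ⟨hu, huy, huv, hc⟩)).not_gt hhu

lemma attachable_congr {x' y' : ι → ℝ} {k : ℝ} (hk : 0 < k)
    (ho : ∀ p q r, orient x' y' p q r = k * orient x y p q r)
    (hd : ∀ p q r, (x' p - x' q) * (x' r - x' q) + (y' p - y' q) * (y' r - y' q) =
      k * ((x p - x q) * (x r - x q) + (y p - y q) * (y r - y q))) (p q : ι) :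
    Attachable S x' y' p q ↔ Attachable S x y p q := by
  have hN : ∀ p q r, Narrow x' y' p q r ↔ Narrow x y p q r := fun p q r => by
    rw [Narrow, Narrow, ho, hd, mul_left_comm, mul_le_mul_iff_right₀ hk]
  simp only [Attachable, hN, ho, mul_pos_iff_of_pos_left hk]

lemma attachable_congr_mirror {x' y' : ι → ℝ} {k : ℝ} (hk : 0 < k)
    (ho : ∀ p q r, orient x' y' p q r = k * orient x y p q r)
    (hd : ∀ p q r, (x' p - x' q) * (x' r - x' q) + (y' p - y' q) * (y' r - y' q) =
      k * ((x p - x q) * (x r - x q) + (y p - y q) * (y r - y q))) (p q : ι) :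
    Attachable S x' (-y') p q ↔ Attachable S x (-y) p q := by
  refine attachable_congr hk (fun p q r => ?_) (fun p q r => ?_) p q
  · rw [orient_mirror, orient_mirror, ho]
  · simp only [Pi.neg_apply]
    linear_combination hd p q r

lemma InLens.rotate (hl : InLens S x y a b) : InLens S (fun r => 1 - x r) (-y) b a where
  ha := hl.hb
  hb := hl.ha
  xa := by simp [hl.xb]
  ya := by simp [hl.yb]
  xb := by simp [hl.xa]
  yb := by simp [hl.ya]
  gp p hp q hq r hr h1 h2 h3 := by
    convert hl.gp p hp q hq r hr h1 h2 h3 using 1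
    simp only [orient, Pi.neg_apply]; ring
  le_a r hr := by simpa using hl.le_b r hr
  le_b r hr := by simpa using hl.le_a r hr

lemma InLens.attachable_ab (hl : InLens S x y a b) (hB : ¬ Attachable S x (-y) b a) :
    Attachable S x y a b := by
  obtain ⟨f, hf, hfy, hfs, -, hfst, -⟩ := hl.exists_good hB
  exact attachable_of_starLike hf (by rwa [hl.orient_ab]) (hl.narrow_b hfs) hfst

lemma InLens.exists_attachable (hl : InLens S x y a b) :
    ∃ p ∈ S, ∃ q ∈ S, p ≠ q ∧ ((Attachable S x y p q ∧ Attachable S x y q p) ∨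
      (Attachable S x (-y) p q ∧ Attachable S x (-y) q p)) := by
  have hr := hl.rotate.exists_attachable_of_not
  have ho : ∀ p q r, orient (fun r => 1 - x r) (-y) p q r = 1 * orient x y p q r :=
    fun p q r => by simp only [orient, Pi.neg_apply]; ring
  have hd : ∀ p q r, ((1 - x p) - (1 - x q)) * ((1 - x r) - (1 - x q)) +
      ((-y) p - (-y) q) * ((-y) r - (-y) q) =
      1 * ((x p - x q) * (x r - x q) + (y p - y q) * (y r - y q)) :=
    fun p q r => by simp only [Pi.neg_apply]; ring
  simp only [attachable_congr one_pos ho hd, attachable_congr_mirror one_pos ho hd] at hr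
  by_cases hu : Attachable S x (-y) b a <;> by_cases hd : Attachable S x y b a
  · by_cases h1 : Attachable S x (-y) a b
    · exact ⟨a, hl.ha, b, hl.hb, hl.a_ne_b, Or.inr ⟨h1, hu⟩⟩
    by_cases h2 : Attachable S x y a b
    · exact ⟨a, hl.ha, b, hl.hb, hl.a_ne_b, Or.inl ⟨h2, hd⟩⟩
    exact hr h1 h2
  · exact ⟨a, hl.ha, b, hl.hb, hl.a_ne_b,
      Or.inr ⟨hl.mirror.attachable_ab (by rwa [neg_neg]), hu⟩⟩
  · exact ⟨a, hl.ha, b, hl.hb, hl.a_ne_b, Or.inl ⟨hl.attachable_ab hu, hd⟩⟩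
  · exact hl.exists_attachable_of_not hu hd

theorem exists_attachable (hS : S.Nontrivial)
    (hinj : ∀ p ∈ S, ∀ q ∈ S, x p = x q → y p = y q → p = q)
    (gp : ∀ p ∈ S, ∀ q ∈ S, ∀ r ∈ S, p ≠ q → p ≠ r → q ≠ r → orient x y p q r ≠ 0) :
    ∃ p ∈ S, ∃ q ∈ S, p ≠ q ∧ ((Attachable S x y p q ∧ Attachable S x y q p) ∨
      (Attachable S x (-y) p q ∧ Attachable S x (-y) q p)) := by
  obtain ⟨u, hu, v, hv, huv⟩ := hS
  obtain ⟨⟨a, b⟩, hab, hmax⟩ := (S ×ˢ S).exists_max_image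
    (fun e => (x e.2 - x e.1) ^ 2 + (y e.2 - y e.1) ^ 2) ⟨(u, v), by simp_all⟩
  simp only [Finset.mem_product, Prod.forall] at hab hmax
  obtain ⟨ha, hb⟩ := hab
  have hD : 0 < (x b - x a) ^ 2 + (y b - y a) ^ 2 := by
    refine lt_of_lt_of_le ?_ (hmax u v ⟨hu, hv⟩)
    by_contra! hc
    have h1 : (x v - x u) ^ 2 = 0 := le_antisymm (by nlinarith [sq_nonneg (y v - y u)]) (sq_nonneg _)
    have h2 : (y v - y u) ^ 2 = 0 := le_antisymm (by nlinarith [sq_nonneg (x v - x u)]) (sq_nonneg _)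
    rw [sq_eq_zero_iff, sub_eq_zero] at h1 h2
    exact huv (hinj u hu v hv h1.symm h2.symm)
  generalize hDD : (x b - x a) ^ 2 + (y b - y a) ^ 2 = D at *
  let X : ι → ℝ := fun r => ((x b - x a) * (x r - x a) + (y b - y a) * (y r - y a)) / D
  let Y : ι → ℝ := fun r => ((x b - x a) * (y r - y a) - (y b - y a) * (x r - x a)) / D
  have ho : ∀ p q r, orient X Y p q r = D⁻¹ * orient x y p q r := fun p q r => by
    simp only [orient, X, Y]
    field_simp
    rw [← hDD]; ring
  have hd : ∀ p q r, (X p - X q) * (X r - X q) + (Y p - Y q) * (Y r - Y q) =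
      D⁻¹ * ((x p - x q) * (x r - x q) + (y p - y q) * (y r - y q)) := fun p q r => by
    simp only [X, Y]
    field_simp
    rw [← hDD]; ring
  have hl : InLens S X Y a b :=
    { ha := ha
      hb := hb
      xa := by simp [X]
      ya := by simp [Y]
      xb := by simp only [X]; rw [div_eq_one_iff_eq hD.ne', ← hDD]; ring
      yb := by simp only [Y]; rw [mul_comm, sub_self, zero_div]
      gp := fun p hp q hq r hr h1 h2 h3 => by
        rw [ho]
        exact mul_ne_zero (inv_ne_zero hD.ne') (gp p hp q hq r hr h1 h2 h3)
      le_a := fun r hr => by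
        have h := hmax a r ⟨ha, hr⟩
        have : X r ^ 2 + Y r ^ 2 = ((x r - x a) ^ 2 + (y r - y a) ^ 2) / D := by
          simp only [X, Y]
          field_simp
          rw [← hDD]; ring
        rw [this]
        exact (div_le_one hD).mpr h
      le_b := fun r hr => by
        have h := hmax b r ⟨hb, hr⟩
        have : (1 - X r) ^ 2 + Y r ^ 2 = ((x r - x b) ^ 2 + (y r - y b) ^ 2) / D := by
          simp only [X, Y]
          field_simp
          rw [← hDD]; ring
        rw [this]
        exact (div_le_one hD).mpr h }
  have := hl.exists_attachable
  simpa only [attachable_congr (inv_pos.mpr hD) ho hd,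
    attachable_congr_mirror (inv_pos.mpr hD) ho hd] using this

end Geometry

section Trees

/-- The segments `e₁ e₂` and `f₁ f₂` meet only at common endpoints. -/
def Noncrossing (e₁ e₂ f₁ f₂ : Pt) : Prop :=
  ∀ z, z ∈ segment ℝ e₁ e₂ → z ∈ segment ℝ f₁ f₂ → (z = e₁ ∨ z = e₂) ∧ (z = f₁ ∨ z = f₂)

lemma Noncrossing.symm {e₁ e₂ f₁ f₂ : Pt} (h : Noncrossing e₁ e₂ f₁ f₂) :
    Noncrossing f₁ f₂ e₁ e₂ := fun z h₁ h₂ => (h z h₂ h₁).symm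

lemma Noncrossing.swap_right {e₁ e₂ f₁ f₂ : Pt} (h : Noncrossing e₁ e₂ f₁ f₂) :
    Noncrossing e₁ e₂ f₂ f₁ := fun z h₁ h₂ =>
  ⟨(h z h₁ (segment_symm ℝ f₁ f₂ ▸ h₂)).1, (h z h₁ (segment_symm ℝ f₁ f₂ ▸ h₂)).2.symm⟩

lemma Noncrossing.swap_left {e₁ e₂ f₁ f₂ : Pt} (h : Noncrossing e₁ e₂ f₁ f₂) :
    Noncrossing e₂ e₁ f₁ f₂ := h.symm.swap_right.symm

/-- A tree given by a parent function towards a root `p`. -/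
lemma exists_tree_of_parent {S : Finset Pt} {p : Pt} (hp : p ∈ S) (par : Pt → Pt) (rank : Pt → ℕ)
    (hpar : ∀ r ∈ S, r ≠ p → par r ∈ S) (hrank : ∀ r ∈ S, r ≠ p → rank (par r) < rank r)
    (hnc : ∀ r ∈ S, r ≠ p → ∀ s ∈ S, s ≠ p → r ≠ s → Noncrossing r (par r) s (par s))
    (hopen : ∀ v ∈ S, ∃ d : Pt, d ≠ 0 ∧
      (v ≠ p → InnerProductGeometry.angle d (par v - v) ≤ Real.pi / 6) ∧
      ∀ r ∈ S, r ≠ p → par r = v → InnerProductGeometry.angle d (r - v) ≤ Real.pi / 6) :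
    ∃ T : PSLG S, T.IsSpanningTree ∧ T.IsPhiOpen (5 * Real.pi / 3) := by
  set A : Finset (Pt × Pt) := (S.erase p).image fun r => (r, par r) with hA
  set B : Finset (Pt × Pt) := (S.erase p).image fun r => (par r, r) with hB
  have hmA : ∀ e, e ∈ A ↔ e.1 ∈ S ∧ e.1 ≠ p ∧ e.2 = par e.1 := by
    rintro ⟨u, v⟩
    simp only [hA, Finset.mem_image, Finset.mem_erase, Prod.mk.injEq]
    constructor
    · rintro ⟨r, ⟨h1, h2⟩, rfl, rfl⟩; exact ⟨h2, h1, rfl⟩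
    · rintro ⟨h1, h2, h3⟩; exact ⟨u, ⟨h2, h1⟩, rfl, h3.symm⟩
  have hmB : ∀ e, e ∈ B ↔ e.2 ∈ S ∧ e.2 ≠ p ∧ e.1 = par e.2 := by
    rintro ⟨u, v⟩
    simp only [hB, Finset.mem_image, Finset.mem_erase, Prod.mk.injEq]
    constructor
    · rintro ⟨r, ⟨h1, h2⟩, rfl, rfl⟩; exact ⟨h2, h1, rfl⟩
    · rintro ⟨h1, h2, h3⟩; exact ⟨v, ⟨h2, h1⟩, h3.symm, rfl⟩
  let T : PSLG S :=
    { E := A ∪ B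
      symm := fun e he => by
        rw [Finset.mem_union, hmA, hmB] at he ⊢
        exact he.symm
      endpts := fun e he => by
        rw [Finset.mem_union, hmA, hmB] at he
        rcases he with ⟨h1, h2, h3⟩ | ⟨h1, h2, h3⟩
        · exact ⟨h1, h3 ▸ hpar _ h1 h2⟩
        · exact ⟨h3 ▸ hpar _ h1 h2, h1⟩
      ne := fun e he h => by
        rw [Finset.mem_union, hmA, hmB] at he
        rcases he with ⟨h1, h2, h3⟩ | ⟨h1, h2, h3⟩
        · exact (hrank _ h1 h2).ne (by rw [← h3, h])
        · exact (hrank _ h1 h2).ne (by rw [← h3, h])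
      noncross := by
        rintro ⟨e₁, e₂⟩ he ⟨f₁, f₂⟩ hf hne hne'
        simp only [Finset.mem_union, hmA, hmB] at he hf
        change Noncrossing e₁ e₂ f₁ f₂
        rcases he with ⟨h1, h2, rfl⟩ | ⟨h1, h2, rfl⟩ <;>
          rcases hf with ⟨k1, k2, rfl⟩ | ⟨k1, k2, rfl⟩
        · exact hnc _ h1 h2 _ k1 k2 (by rintro rfl; exact hne rfl)
        · exact (hnc _ h1 h2 _ k1 k2 (by rintro rfl; exact hne' rfl)).swap_right
        · exact (hnc _ h1 h2 _ k1 k2 (by rintro rfl; exact hne' rfl)).swap_left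
        · exact (hnc _ h1 h2 _ k1 k2 (by rintro rfl; exact hne rfl)).swap_left.swap_right }
  have hTE : T.E = A ∪ B := rfl
  have hup : ∀ n, ∀ r ∈ S, rank r = n → Relation.ReflTransGen (fun a b => (a, b) ∈ T.E) r p ∧
      Relation.ReflTransGen (fun a b => (a, b) ∈ T.E) p r := by
    intro n
    induction n using Nat.strong_induction_on with
    | _ n ih =>
      intro r hr hn
      by_cases hrp : r = p
      · rw [hrp]; exact ⟨.refl, .refl⟩
      · obtain ⟨h1, h2⟩ := ih _ (hn ▸ hrank r hr hrp) (par r) (hpar r hr hrp) rfl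
        refine ⟨h1.head ?_, h2.tail ?_⟩
        · exact Finset.mem_union_left _ ((hmA _).mpr ⟨hr, hrp, rfl⟩)
        · exact Finset.mem_union_right _ ((hmB _).mpr ⟨hr, hrp, rfl⟩)
  refine ⟨T, ⟨fun u hu v hv => (hup _ u hu rfl).1.trans (hup _ v hv rfl).2, ?_⟩, fun v hv => ?_⟩
  · rw [hTE, Finset.card_union_of_disjoint, hA, hB, Finset.card_image_of_injective,
      Finset.card_image_of_injective, Finset.card_erase_of_mem hp, two_mul]
    · exact fun u v h => (Prod.mk.inj h).2
    · exact fun u v h => (Prod.mk.inj h).1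
    · rw [Finset.disjoint_left]
      rintro ⟨u, v⟩ h1 h2
      obtain ⟨a1, a2, a3⟩ := (hmA _).mp h1
      obtain ⟨b1, b2, b3⟩ := (hmB _).mp h2
      simp only at a1 a2 a3 b1 b2 b3
      have i1 := hrank _ a1 a2
      have i2 := hrank _ b1 b2
      rw [← a3] at i1
      rw [← b3] at i2
      omega
  · obtain ⟨d, hd, h1, h2⟩ := hopen v hv
    refine ⟨d, hd, fun u hu => ?_⟩
    rw [show Real.pi - 5 * Real.pi / 3 / 2 = Real.pi / 6 by ring]
    rw [hTE, Finset.mem_union, hmA, hmB] at hu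
    rcases hu with ⟨-, h3, h4⟩ | ⟨h3, h4, h5⟩
    · simp only at h3 h4
      rw [h4]; exact h1 h3
    · exact h2 u h3 h4 h5.symm

/-- `x` and `y` are the coordinates with respect to an orthonormal basis. -/
structure OrthoCoords (x y : Pt →ₗ[ℝ] ℝ) : Prop where
  inner_eq : ∀ p q : Pt, inner ℝ p q = x p * x q + y p * y q
  surj : ∀ s t, ∃ p, x p = s ∧ y p = t

variable {x y : Pt →ₗ[ℝ] ℝ} {S : Finset Pt}

lemma OrthoCoords.mirror (h : OrthoCoords x y) : OrthoCoords x (-y) where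
  inner_eq p q := by simp [h.inner_eq]
  surj s t := by
    obtain ⟨p, hp, hq⟩ := h.surj s (-t)
    exact ⟨p, hp, by simp [hq]⟩

lemma OrthoCoords.norm_sq (h : OrthoCoords x y) (p : Pt) : ‖p‖ ^ 2 = x p ^ 2 + y p ^ 2 := by
  rw [← real_inner_self_eq_norm_sq, h.inner_eq]; ring

lemma OrthoCoords.inj (h : OrthoCoords x y) {p q : Pt} (hx : x p = x q) (hy : y p = y q) :
    p = q := by
  rw [← sub_eq_zero, ← norm_eq_zero, ← sq_eq_zero_iff, h.norm_sq]
  simp [hx, hy]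

lemma OrthoCoords.exists_cone (h : OrthoCoords x y) {u : Pt} (hu : u ≠ 0) :
    ∃ d : Pt, d ≠ 0 ∧ ∀ w : Pt, w ≠ 0 → 0 ≤ x u * y w - y u * x w →
      x u * y w - y u * x w ≤ √3 * (x u * x w + y u * y w) →
        InnerProductGeometry.angle d w ≤ Real.pi / 6 := by
  have e3 : √3 ^ 2 = 3 := Real.sq_sqrt (by norm_num)
  have h30 : (0 : ℝ) < √3 := Real.sqrt_pos.mpr (by norm_num)
  obtain ⟨d, hx, hy⟩ := h.surj (√3 / 2 * x u - 1 / 2 * y u) (1 / 2 * x u + √3 / 2 * y u)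
  have hd : ‖d‖ = ‖u‖ := by
    rw [← sq_eq_sq₀ (norm_nonneg _) (norm_nonneg _), h.norm_sq, h.norm_sq, hx, hy]
    linear_combination (x u ^ 2 + y u ^ 2) / 4 * e3
  have hu0 : 0 < ‖u‖ := norm_pos_iff.mpr hu
  refine ⟨d, norm_pos_iff.mp (hd ▸ hu0), fun w hw h1 h2 => ?_⟩
  have hw0 : 0 < ‖w‖ := norm_pos_iff.mpr hw
  rw [InnerProductGeometry.angle, show Real.pi / 6 = Real.arccos (√3 / 2) by
    rw [← Real.cos_pi_div_six, Real.arccos_cos] <;> linarith [Real.pi_pos]]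
  apply Real.arccos_le_arccos
  rw [le_div_iff₀ (mul_pos (hd ▸ hu0) hw0), hd, h.inner_eq, hx, hy]
  have hD : 0 ≤ x u * x w + y u * y w := nonneg_of_mul_nonneg_right (h1.trans h2) h30
  have hR : (√3 / 2 * x u - 1 / 2 * y u) * x w + (1 / 2 * x u + √3 / 2 * y u) * y w =
    √3 / 2 * (x u * x w + y u * y w) + 1 / 2 * (x u * y w - y u * x w) := by ring
  rw [hR]
  refine le_of_sq_le_sq ?_ (by positivity)
  have hn : (√3 / 2 * (‖u‖ * ‖w‖)) ^ 2 =
      3 / 4 * ((x u * x w + y u * y w) ^ 2 + (x u * y w - y u * x w) ^ 2) := by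
    rw [mul_pow, mul_pow, h.norm_sq, h.norm_sq, div_pow, e3]; ring
  rw [hn]
  generalize x u * x w + y u * y w = D at *
  generalize x u * y w - y u * x w = C at *
  have := mul_le_mul_of_nonneg_right h2 h1
  nlinarith

lemma orient_combo (p q e f : Pt) {s t : ℝ} (hst : s + t = 1) :
    orient x y p q (s • e + t • f) = s * orient x y p q e + t * orient x y p q f := by
  simp only [orient, map_add, map_smul, smul_eq_mul]
  linear_combination ((x q - x p) * y p - (y q - y p) * x p) * hst

lemma orient_of_mem_segment {p q e f z : Pt} (hz : z ∈ segment ℝ e f)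
    (he : 0 < orient x y p q e) (hf : 0 ≤ orient x y p q f) :
    0 ≤ orient x y p q z ∧ (orient x y p q z ≤ 0 → z = f) := by
  obtain ⟨s, t, hs, ht, hst, rfl⟩ := hz
  rw [orient_combo p q e f hst]
  refine ⟨by positivity, fun h0 => ?_⟩
  have hs0 : s = 0 := by
    by_contra hne
    have : 0 < s := lt_of_le_of_ne hs (Ne.symm hne)
    nlinarith [mul_pos this he, mul_nonneg ht hf]
  subst hs0
  rw [zero_add] at hst
  simp [hst]

lemma noncrossing_of_orient {p q e₁ e₂ f₁ f₂ : Pt} (he₁ : 0 < orient x y p q e₁)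
    (he₂ : 0 ≤ orient x y p q e₂) (hf₁ : 0 < orient x y q p f₁) (hf₂ : 0 ≤ orient x y q p f₂) :
    Noncrossing e₁ e₂ f₁ f₂ := by
  intro z h1 h2
  obtain ⟨i1, i2⟩ := orient_of_mem_segment h1 he₁ he₂
  obtain ⟨j1, j2⟩ := orient_of_mem_segment h2 hf₁ hf₂
  rw [orient_swap] at j1 j2
  exact ⟨Or.inr (i2 (by linarith)), Or.inr (j2 (by linarith))⟩

lemma noncrossing_star {c r s : Pt} (h : orient x y c r s ≠ 0) : Noncrossing r c s c := by
  intro z ⟨k, t, hk, ht, hkt, h1⟩ ⟨k', t', hk', ht', hkt', h2⟩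
  have e1 : orient x y c r z = 0 := by
    rw [← h1, orient_combo _ _ _ _ hkt, orient_self_right, orient_self_mid]; ring
  have e2 : orient x y c r z = k' * orient x y c r s := by
    rw [← h2, orient_combo _ _ _ _ hkt', orient_self_mid]; ring
  have hk0 : k' = 0 := by
    rw [e1] at e2
    exact (mul_eq_zero.mp e2.symm).resolve_right h
  subst hk0
  rw [zero_add] at hkt'
  have : z = c := by rw [← h2, hkt']; simp
  exact ⟨Or.inr this, Or.inr this⟩

lemma OrthoCoords.exists_half (h : OrthoCoords x y) {p q : Pt}
    (gp : ∀ p ∈ S, ∀ q ∈ S, ∀ r ∈ S, p ≠ q → p ≠ r → q ≠ r → orient x y p q r ≠ 0)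
    (hp : p ∈ S) (hat : Attachable S x y p q) :
    ∃ f : Pt → Pt, (∀ r ∈ S, 0 < orient x y p q r →
      (f r = p ∧ Narrow x y r p q ∨ f r ∈ S ∧ 0 < orient x y p q (f r) ∧ f (f r) = p) ∧
      (∀ s ∈ S, 0 < orient x y p q s → r ≠ s → Noncrossing r (f r) s (f s)) ∧
      ∃ d : Pt, d ≠ 0 ∧ InnerProductGeometry.angle d (f r - r) ≤ Real.pi / 6 ∧
        ∀ s ∈ S, 0 < orient x y p q s → f s = r →
          InnerProductGeometry.angle d (s - r) ≤ Real.pi / 6) := by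
  rcases hat with hat | ⟨c, hc, hc0, hcn, hcs⟩
  · exact ⟨id, fun r hr h0 => absurd h0 (hat r hr)⟩
  have hne : ∀ r, 0 < orient x y p q r → r ≠ p := by
    rintro r h0 rfl
    simp [orient_self_mid] at h0
  have hcp := hne c hc0
  have hfc : ¬ 0 < orient x y p c c := by simp [orient_self_right]
  refine ⟨fun r => if 0 < orient x y p c r then c else p, fun r hr hr0 => ⟨?_, ?_, ?_⟩⟩
  · by_cases hrc : 0 < orient x y p c r
    · exact Or.inr (by simp [hrc, hc, hc0, orient_self_right])
    · refine Or.inl ⟨by simp [hrc], hcn.of_between ?_ hr0.le hc0⟩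
      have : orient x y p r c = - orient x y p c r := by
        simp only [orient]; ring
      linarith
  · have key : ∀ r ∈ S, 0 < orient x y p q r → ∀ s ∈ S, 0 < orient x y p q s → r ≠ s →
        0 < orient x y p c r → ¬ 0 < orient x y p c s → Noncrossing r c s p := by
      intro r hr hr0 s hs hs0 hrs hrc hsc z h1 h2
      have hrc' : r ≠ c := by rintro rfl; exact hfc hrc
      obtain ⟨i1, i2⟩ := orient_of_mem_segment h1 hrc (orient_self_right x y p c).ge
      by_cases hscc : s = c
      · subst hscc
        exact noncrossing_star (x := x) (y := y) (gp s hs r hr p hp hrc'.symm hcp (hne r hr0))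
          |>.swap_right.swap_right z h1 (segment_symm ℝ s p ▸ h2) |>.imp id Or.symm
      · have h0 : 0 < orient x y c p s := by
          rw [orient_swap]
          have := gp p hp c hc s hs hcp.symm (hne s hs0).symm (Ne.symm hscc)
          push Not at hsc
          linarith [lt_of_le_of_ne hsc this]
        obtain ⟨j1, j2⟩ := orient_of_mem_segment h2 h0 (orient_self_right x y c p).ge
        rw [orient_swap] at j1 j2
        exact ⟨Or.inr (i2 (by linarith)), Or.inr (j2 (by linarith))⟩
    intro s hs hs0 hrs
    by_cases hrc : 0 < orient x y p c r <;> by_cases hsc : 0 < orient x y p c s <;>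
      simp only [hrc, hsc, if_true, if_false]
    · refine noncrossing_star (x := x) (y := y) (gp c hc r hr s hs ?_ ?_ hrs)
      · rintro rfl; exact hfc hrc
      · rintro rfl; exact hfc hsc
    · exact key r hr hr0 s hs hs0 hrs hrc hsc
    · exact (key s hs hs0 r hr hr0 hrs.symm hsc hrc).symm
    · exact noncrossing_star (x := x) (y := y)
        (gp p hp r hr s hs (hne r hr0).symm (hne s hs0).symm hrs)
  · by_cases hrc : r = c
    · subst hrc
      obtain ⟨d, hd, hcone⟩ := h.mirror.exists_cone (sub_ne_zero.mpr hcp.symm)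
      refine ⟨d, hd, ?_, fun s hs hs0 hsr => ?_⟩
      · simp only [hfc, if_false]
        refine hcone _ (sub_ne_zero.mpr hcp.symm) (by simp [mul_comm]) ?_
        simp only [LinearMap.neg_apply]
        have : 0 ≤ √3 * (x (p - r) ^ 2 + y (p - r) ^ 2) := by positivity
        linarith
      · have hsc : 0 < orient x y p r s := by
          by_contra hsc
          simp only [hsc, if_false] at hsr
          exact hcp hsr.symm
        have hN := hcs s hs hs0 hsc
        rw [Narrow] at hN
        refine hcone _ (sub_ne_zero.mpr ?_) ?_ ?_
        · rintro rfl; exact hfc hsc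
        · simp only [LinearMap.neg_apply, map_sub]
          simp only [orient] at hsc
          linarith
        · simp only [LinearMap.neg_apply, map_sub]
          simp only [orient] at hN
          linarith
    · set f := if 0 < orient x y p c r then c else p with hf
      have hfr : f - r ≠ 0 := by
        rw [sub_ne_zero, hf]
        split_ifs
        · exact Ne.symm hrc
        · exact (hne r hr0).symm
      refine ⟨f - r, hfr, ?_, fun s hs hs0 hsr => ?_⟩
      · rw [InnerProductGeometry.angle_self hfr]
        positivity
      · simp only at hsr
        split_ifs at hsr
        · exact absurd hsr.symm hrc
        · exact absurd hsr.symm (hne r hr0)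

lemma OrthoCoords.exists_tree (h : OrthoCoords x y) {p q : Pt}
    (gp : ∀ p ∈ S, ∀ q ∈ S, ∀ r ∈ S, p ≠ q → p ≠ r → q ≠ r → orient x y p q r ≠ 0)
    (hp : p ∈ S) (hq : q ∈ S) (hpq : p ≠ q) (hpat : Attachable S x y p q)
    (hqat : Attachable S x y q p) :
    ∃ T : PSLG S, T.IsSpanningTree ∧ T.IsPhiOpen (5 * Real.pi / 3) := by
  obtain ⟨f, hf⟩ := h.exists_half gp hp hpat
  obtain ⟨g, hg⟩ := h.exists_half gp hq hqat
  have hside : ∀ r ∈ S, r ≠ p → r ≠ q →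
      (0 < orient x y p q r ∨ 0 < orient x y q p r ∧ ¬ 0 < orient x y p q r) := by
    intro r hr h1 h2
    have := gp p hp q hq r hr hpq h1.symm h2.symm
    rw [orient_swap x y q p]
    rcases lt_or_gt_of_ne this with h | h
    · exact Or.inr ⟨by linarith, h.not_gt⟩
    · exact Or.inl h
  have hLp : ∀ {r}, 0 < orient x y p q r → r ≠ p := by
    rintro r h0 rfl; simp [orient_self_mid] at h0
  have hLq : ∀ {r}, 0 < orient x y p q r → r ≠ q := by
    rintro r h0 rfl; simp [orient_self_right] at h0
  have hRp : ∀ {r}, 0 < orient x y q p r → r ≠ p := by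
    rintro r h0 rfl; simp [orient_self_right] at h0
  have hRq : ∀ {r}, 0 < orient x y q p r → r ≠ q := by
    rintro r h0 rfl; simp [orient_self_mid] at h0
  have hLR : ∀ {r}, 0 < orient x y q p r → ¬ 0 < orient x y p q r := by
    intro r h0; rw [orient_swap] at h0; linarith
  let par : Pt → Pt := fun r => if r = q then p else if 0 < orient x y p q r then f r else g r
  let rank : Pt → ℕ := fun r => if r = p then 0 else if r = q then 1 else
    if 0 < orient x y p q r then (if f r = p then 1 else 2) else (if g r = q then 2 else 3)
  have parq : par q = p := by simp [par]
  have parL : ∀ {r}, 0 < orient x y p q r → par r = f r := fun h0 => by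
    simp [par, hLq h0, h0]
  have parR : ∀ {r}, 0 < orient x y q p r → par r = g r := fun h0 => by
    simp [par, hRq h0, hLR h0]
  have hfL : ∀ r ∈ S, 0 < orient x y p q r → f r ∈ S ∧ 0 ≤ orient x y p q (f r) ∧ f r ≠ q ∧
      (f r ≠ p → 0 < orient x y p q (f r)) := by
    intro r hr h0
    rcases (hf r hr h0).1 with ⟨h1, -⟩ | ⟨h1, h2, -⟩
    · rw [h1]; exact ⟨hp, (orient_self_mid x y p q).ge, hpq, fun h => absurd rfl h⟩
    · exact ⟨h1, h2.le, hLq h2, fun _ => h2⟩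
  have hgR : ∀ r ∈ S, 0 < orient x y q p r → g r ∈ S ∧ 0 ≤ orient x y q p (g r) ∧ g r ≠ p ∧
      (g r ≠ q → 0 < orient x y q p (g r)) := by
    intro r hr h0
    rcases (hg r hr h0).1 with ⟨h1, -⟩ | ⟨h1, h2, -⟩
    · rw [h1]; exact ⟨hq, (orient_self_mid x y q p).ge, hpq.symm, fun h => absurd rfl h⟩
    · exact ⟨h1, h2.le, hRp h2, fun _ => h2⟩
  have hseg : ∀ z ∈ segment ℝ q p, orient x y p q z = 0 := by
    rintro z ⟨s, t, -, -, hst, rfl⟩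
    rw [orient_combo _ _ _ _ hst, orient_self_right, orient_self_mid]; ring
  have ncL : ∀ r ∈ S, 0 < orient x y p q r → Noncrossing r (f r) q p := by
    intro r hr h0 z h1 h2
    obtain ⟨k1, k2, k3, k4⟩ := hfL r hr h0
    have hz := (orient_of_mem_segment h1 h0 k2).2 (hseg z h2).le
    refine ⟨Or.inr hz, Or.inr (hz.trans ?_)⟩
    by_contra hne
    have := k4 hne
    rw [← hz, hseg z h2] at this
    exact lt_irrefl _ this
  have ncR : ∀ r ∈ S, 0 < orient x y q p r → Noncrossing r (g r) q p := by
    intro r hr h0 z h1 h2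
    obtain ⟨k1, k2, k3, k4⟩ := hgR r hr h0
    have h3 : orient x y q p z = 0 := by rw [orient_swap, hseg z h2, neg_zero]
    have hz := (orient_of_mem_segment h1 h0 k2).2 h3.le
    refine ⟨Or.inr hz, Or.inl (hz.trans ?_)⟩
    by_contra hne
    have := k4 hne
    rw [← hz, h3] at this
    exact lt_irrefl _ this
  have ncLR : ∀ r ∈ S, 0 < orient x y p q r → ∀ s ∈ S, 0 < orient x y q p s →
      Noncrossing r (f r) s (g s) := fun r hr hr0 s hs hs0 =>
    noncrossing_of_orient hr0 (hfL r hr hr0).2.1 hs0 (hgR s hs hs0).2.1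
  refine exists_tree_of_parent hp par rank ?_ ?_ ?_ ?_
  · intro r hr hrp
    by_cases hrq : r = q
    · rw [hrq, parq]; exact hp
    rcases hside r hr hrp hrq with h0 | ⟨h0, -⟩
    · rw [parL h0]; exact (hfL r hr h0).1
    · rw [parR h0]; exact (hgR r hr h0).1
  · intro r hr hrp
    by_cases hrq : r = q
    · rw [hrq, parq]; simp [rank, hpq.symm]
    rcases hside r hr hrp hrq with h0 | ⟨h0, h0'⟩
    · rw [parL h0]
      rcases (hf r hr h0).1 with ⟨h1, -⟩ | ⟨h1, h2, h3⟩
      · simp [rank, h1, hrp, hrq, h0]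
      · simp [rank, hrp, hrq, h0, h2, h3, hLp h2, hLq h2]
    · rw [parR h0]
      rcases (hg r hr h0).1 with ⟨h1, -⟩ | ⟨h1, h2, h3⟩
      · simp [rank, h1, hrp, hrq, h0', hpq.symm]
      · simp [rank, hrp, hrq, h0', h3, hRp h2, hRq h2, hLR h2]
  · intro r hr hrp s hs hsp hrs
    by_cases hrq : r = q
    · have hsq : s ≠ q := fun h => hrs (hrq.trans h.symm)
      rw [hrq, parq]
      rcases hside s hs hsp hsq with h0 | ⟨h0, -⟩
      · rw [parL h0]; exact (ncL s hs h0).symm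
      · rw [parR h0]; exact (ncR s hs h0).symm
    by_cases hsq : s = q
    · rw [hsq, parq]
      rcases hside r hr hrp hrq with h0 | ⟨h0, -⟩
      · rw [parL h0]; exact ncL r hr h0
      · rw [parR h0]; exact ncR r hr h0
    rcases hside r hr hrp hrq with h0 | ⟨h0, -⟩ <;>
      rcases hside s hs hsp hsq with k0 | ⟨k0, -⟩
    · rw [parL h0, parL k0]; exact (hf r hr h0).2.1 s hs k0 hrs
    · rw [parL h0, parR k0]; exact ncLR r hr h0 s hs k0
    · rw [parR h0, parL k0]; exact (ncLR s hs k0 r hr h0).symm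
    · rw [parR h0, parR k0]; exact (hg r hr h0).2.1 s hs k0 hrs
  · have cone : ∀ {p q : Pt}, p ≠ q → ∃ d : Pt, d ≠ 0 ∧
        InnerProductGeometry.angle d (q - p) ≤ Real.pi / 6 ∧
        ∀ r, r ≠ p → 0 < orient x y p q r → Narrow x y r p q →
          InnerProductGeometry.angle d (r - p) ≤ Real.pi / 6 := by
      intro p q hpq
      obtain ⟨d, hd, hcone⟩ := h.exists_cone (sub_ne_zero.mpr hpq.symm)
      refine ⟨d, hd, hcone _ (sub_ne_zero.mpr hpq.symm) (by simp [mul_comm]) ?_,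
        fun r hrp h0 hN => hcone _ (sub_ne_zero.mpr hrp) ?_ ?_⟩
      · have : 0 ≤ √3 * (x (q - p) ^ 2 + y (q - p) ^ 2) := by positivity
        linarith
      · simp only [orient] at h0
        simp only [map_sub]
        exact h0.le
      · rw [Narrow, orient_cycle] at hN
        simp only [orient] at hN
        simp only [map_sub]
        linarith
    intro v hv
    by_cases hvp : v = p
    · subst hvp
      obtain ⟨d, hd, h1, h2⟩ := cone hpq
      refine ⟨d, hd, fun h => absurd rfl h, fun r hr hrp hpar => ?_⟩
      by_cases hrq : r = q
      · rw [hrq]; exact h1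
      rcases hside r hr hrp hrq with h0 | ⟨h0, -⟩
      · rw [parL h0] at hpar
        rcases (hf r hr h0).1 with ⟨-, h3⟩ | ⟨-, h3, -⟩
        · exact h2 r hrp h0 h3
        · exact absurd hpar (hLp h3)
      · rw [parR h0] at hpar
        exact absurd hpar (hgR r hr h0).2.2.1
    by_cases hvq : v = q
    · subst hvq
      obtain ⟨d, hd, h1, h2⟩ := cone hpq.symm
      refine ⟨d, hd, fun _ => by rwa [parq], fun r hr hrp hpar => ?_⟩
      by_cases hrq : r = v
      · rw [hrq, parq] at hpar
        exact absurd hpar hpq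
      rcases hside r hr hrp hrq with h0 | ⟨h0, -⟩
      · rw [parL h0] at hpar
        exact absurd hpar (hfL r hr h0).2.2.1
      · rw [parR h0] at hpar
        rcases (hg r hr h0).1 with ⟨-, h3⟩ | ⟨-, h3, -⟩
        · exact h2 r hrq h0 h3
        · exact absurd hpar (hRq h3)
    rcases hside v hv hvp hvq with h0 | ⟨h0, h0'⟩
    · obtain ⟨d, hd, h1, h2⟩ := (hf v hv h0).2.2
      refine ⟨d, hd, fun _ => by rwa [parL h0], fun r hr hrp hpar => ?_⟩
      by_cases hrq : r = q
      · rw [hrq, parq] at hpar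
        exact absurd hpar.symm hvp
      rcases hside r hr hrp hrq with k0 | ⟨k0, -⟩
      · rw [parL k0] at hpar
        exact h2 r hr k0 hpar
      · rw [parR k0] at hpar
        have := (hgR r hr k0).2.1
        rw [hpar, orient_swap] at this
        linarith
    · obtain ⟨d, hd, h1, h2⟩ := (hg v hv h0).2.2
      refine ⟨d, hd, fun _ => by rwa [parR h0], fun r hr hrp hpar => ?_⟩
      by_cases hrq : r = q
      · rw [hrq, parq] at hpar
        exact absurd hpar.symm hvp
      rcases hside r hr hrp hrq with k0 | ⟨k0, -⟩
      · rw [parL k0] at hpar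
        have := (hfL r hr k0).2.1
        rw [hpar, orient_swap] at this
        linarith
      · rw [parR k0] at hpar
        exact h2 r hr k0 hpar

/-- The first coordinate. -/
noncomputable def coordX : Pt →ₗ[ℝ] ℝ := (EuclideanSpace.proj (0 : Fin 2) : Pt →L[ℝ] ℝ)

/-- The second coordinate. -/
noncomputable def coordY : Pt →ₗ[ℝ] ℝ := (EuclideanSpace.proj (1 : Fin 2) : Pt →L[ℝ] ℝ)

lemma orthoCoords_standard : OrthoCoords coordX coordY where
  inner_eq p q := by
    simp [coordX, coordY, PiLp.inner_apply, Fin.sum_univ_two, mul_comm]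
  surj s t := ⟨!₂[s, t], by simp [coordX], by simp [coordY]⟩

lemma OrthoCoords.orient_ne_zero (h : OrthoCoords x y) (hgp : GenPos S) : ∀ p ∈ S, ∀ q ∈ S,
    ∀ r ∈ S, p ≠ q → p ≠ r → q ≠ r → orient x y p q r ≠ 0 := by
  intro p hp q hq r hr hpq hpr hqr h0
  apply hgp p hp q hq r hr hpq hpr hqr
  have hD : (x q - x p) ^ 2 + (y q - y p) ^ 2 ≠ 0 := by
    rw [← map_sub, ← map_sub, ← h.norm_sq]
    exact pow_ne_zero 2 (norm_ne_zero_iff.mpr (sub_ne_zero.mpr hpq.symm))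
  simp only [orient] at h0
  rw [collinear_iff_of_mem (p₀ := p) (by simp)]
  refine ⟨q - p, ?_⟩
  simp only [Set.mem_insert_iff, Set.mem_singleton_iff, forall_eq_or_imp, forall_eq]
  refine ⟨⟨0, by simp⟩, ⟨1, by simp⟩,
    ⟨((x q - x p) * (x r - x p) + (y q - y p) * (y r - y p)) /
      ((x q - x p) ^ 2 + (y q - y p) ^ 2), h.inj ?_ ?_⟩⟩
  · simp only [vadd_eq_add, map_add, map_smul, map_sub, smul_eq_mul]
    field_simp
    linear_combination -(y q - y p) * h0
  · simp only [vadd_eq_add, map_add, map_smul, map_sub, smul_eq_mul]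
    field_simp
    linear_combination (x q - x p) * h0

end Trees

/-- Every finite point set in general position admits a `5π/3`-open plane spanning
tree. -/
theorem stmt8 (S : Finset Pt) (hgp : GenPos S) (hne : S.Nonempty) :
    ∃ T : PSLG S, T.IsSpanningTree ∧ T.IsPhiOpen (5 * Real.pi / 3) := by
  rcases hne.exists_eq_singleton_or_nontrivial with ⟨p, rfl⟩ | hnt
  · refine exists_tree_of_parent (Finset.mem_singleton_self p) id (fun _ => 0) ?_ ?_ ?_ ?_
    all_goals simp only [Finset.mem_singleton]
    · exact fun r hr h => absurd hr h
    · exact fun r hr h => absurd hr h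
    · exact fun r hr h => absurd hr h
    · exact fun v hv => ⟨!₂[1, 0], fun h => by simpa using congrArg (fun u : Pt => u 0) h,
        fun h => absurd hv h, fun r hr h => absurd hr h⟩
  · have h := orthoCoords_standard
    obtain ⟨p, hp, q, hq, hpq, ⟨h1, h2⟩ | ⟨h1, h2⟩⟩ := exists_attachable hnt
      (fun p _ q _ hx hy => h.inj hx hy) (h.orient_ne_zero hgp)
    · exact h.exists_tree (h.orient_ne_zero hgp) hp hq hpq h1 h2
    · exact h.mirror.exists_tree (h.mirror.orient_ne_zero hgp) hp hq hpq h1 h2
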